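/- Fix 0 < p < q ≤ 1/2 and a rate R with 1 − H(q) < R < 1 − H(p), and let N = ⌈2^{nR}⌉. For all sufficiently small ε₁, ε₂, δ > 0 there exist β > 0 and a constant c such that the following holds for all sufficiently large n. Fix any z ∈ {0,1}^n, any integer d with |d − qn| ≤ ε₁·n, any s ∈ {0,1}^n of Hamming weight at most pn, and any subset M of {1,…,N} with 2^{n(H(d/n)+R−1−ε₂)} ≤ |M| ≤ 2^{n(H(d/n)+R−1+ε₂)}. Let the codewords (X^n(w))_{w∈M} be independent and uniform on the Hamming shell Sh(z,d) and the codewords (X^n(w))_{w∉M} independent and uniform on {0,1}^n \ Sh(z,d), the families mutually independent. Partition M, in increasing order of message value, into consecutive blocks of size ⌈2^{nδ}⌉ (the last possibly smaller), and arrange the codewords of each full block M^{(k)} into a square array indexed by A × A with |A| = 2^{⌈nδ⌉/2}, writing X^n(i,j) for the entry in row i and column j. Then with probability at least 1 − e^{−β·n²}, for every full block M^{(k)}: (i) for every row i there are at most c²·n⁴ codewords X^n(i,j) in that row for which some codeword X^n(i',j') with i' ≠ i satisfies d_H(X^n(i,j) ⊕ s, X^n(i',j')) ≤ (p+ε₁)·n;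 and (ii) there are at most 2^{n·(3δ/4)} messages w ∈ M^{(k)} for which some other message w' ∈ M^{(k)}, w' ≠ w, satisfies d_H(X^n(w) ⊕ s, X^n(w')) ≤ (p+ε₁)·n. -/

import Mathlib

open scoped BigOperators Classical

/-- Binary entropy function (in bits). -/
noncomputable def binH (t : ℝ) : ℝ := -t * Real.logb 2 t - (1 - t) * Real.logb 2 (1 - t)

/-- Hamming weight of a binary vector. -/
def wt {n : ℕ} (s : Fin n → Bool) : ℕ := (Finset.univ.filter fun t => s t = true).card

/-- Coordinatewise XOR of binary vectors. -/
def xorVec {n : ℕ} (x s : Fin n → Bool) : Fin n → Bool := fun t => xor (x t) (s t)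

/-- Probability mass of the codebook `C` when the codewords with index in `M` are drawn
independently and uniformly from the Hamming shell `Sh(z,d)` and the remaining codewords
are drawn independently and uniformly from its complement (this is the conditional
distribution of an i.i.d.-uniform code given that exactly the messages in `M` have
codewords on `Sh(z,d)`). -/
noncomputable def shellCodeProb (n N : ℕ) (M : Finset (Fin N)) (z : Fin n → Bool) (d : ℕ)
    (C : Fin N → Fin n → Bool) : ℝ :=
  ∏ w : Fin N,
    if w ∈ M then
      (if hammingDist (C w) z = d then
        (1 : ℝ) / (Nat.card {x : Fin n → Bool // hammingDist x z = d} : ℝ)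
      else 0)
    else
      (if hammingDist (C w) z = d then 0
      else (1 : ℝ) /
        ((2 : ℝ) ^ n - (Nat.card {x : Fin n → Bool // hammingDist x z = d} : ℝ)))

/-- The rank (0-indexed position in increasing order) of `w` inside the finset `M`. -/
def rankIn {N : ℕ} (M : Finset (Fin N)) (w : Fin N) : ℕ :=
  (M.filter fun w' => w' < w).card

/-- The `k`-th consecutive block (0-indexed) of size `B` in the partition of `M` taken in
increasing order of message value. -/
def blockOf {N : ℕ} (M : Finset (Fin N)) (B k : ℕ) : Finset (Fin N) :=
  M.filter fun w => rankIn M w / B = k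

/-- The number of blocks in the partition of `M` into consecutive blocks of size `B`
(the last block possibly smaller). -/
def numBlocks {N : ℕ} (M : Finset (Fin N)) (B : ℕ) : ℕ := (M.card + B - 1) / B

/-- Expectation of `F` when the coordinates `C w` are independent with mass functions `μ w`. -/
noncomputable def prodExp {ι α : Type*} [Fintype ι] [DecidableEq ι] [Fintype α]
    (μ : ι → α → ℝ) (F : (ι → α) → ℝ) : ℝ :=
  ∑ C : ι → α, (∏ w, μ w (C w)) * F C

section ProdExp

variable {ι α : Type*} [Fintype ι] [DecidableEq ι] [Fintype α] {μ : ι → α → ℝ}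

lemma prodExp_one (h1 : ∀ w, ∑ a, μ w a = 1) : prodExp μ (fun _ => 1) = 1 := by
  have h := Finset.prod_univ_sum (fun _ : ι => (Finset.univ : Finset α)) μ
  simp only [h1, Finset.prod_const_one, Fintype.piFinset_univ] at h
  simp [prodExp, ← h]

lemma prodExp_mono (h0 : ∀ w a, 0 ≤ μ w a) {F G : (ι → α) → ℝ} (h : ∀ C, F C ≤ G C) :
    prodExp μ F ≤ prodExp μ G :=
  Finset.sum_le_sum fun C _ =>
    mul_le_mul_of_nonneg_left (h C) (Finset.prod_nonneg fun w _ => h0 w _)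

lemma prodExp_add (F G : (ι → α) → ℝ) :
    prodExp μ (fun C => F C + G C) = prodExp μ F + prodExp μ G := by
  simp only [prodExp, mul_add, Finset.sum_add_distrib]

lemma prodExp_sum {κ : Type*} (s : Finset κ) (F : κ → (ι → α) → ℝ) :
    prodExp μ (fun C => ∑ k ∈ s, F k C) = ∑ k ∈ s, prodExp μ (F k) := by
  simp only [prodExp, Finset.mul_sum]
  exact Finset.sum_comm

/-- Resampling one coordinate does not change the expectation. -/
lemma prodExp_resample (w : ι) (h1 : ∑ a, μ w a = 1) (F : (ι → α) → ℝ) :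
    prodExp μ F = prodExp μ (fun C => ∑ a, μ w a * F (Function.update C w a)) := by
  have key : ∀ (C : ι → α) (a : α),
      (∏ v, μ v (Function.update C w a v)) * μ w (C w) = (∏ v, μ v (C v)) * μ w a := by
    intro C a
    rw [← Finset.mul_prod_erase _ _ (Finset.mem_univ w),
      ← Finset.mul_prod_erase _ (fun v => μ v (C v)) (Finset.mem_univ w)]
    have : ∏ v ∈ Finset.univ.erase w, μ v (Function.update C w a v)
        = ∏ v ∈ Finset.univ.erase w, μ v (C v) :=
      Finset.prod_congr rfl fun v hv => by
        rw [Function.update_of_ne (Finset.ne_of_mem_erase hv)]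
    rw [this, Function.update_self]
    ring
  have hswap : Function.Involutive
      (fun x : (ι → α) × α => (Function.update x.1 w x.2, x.1 w)) := by
    rintro ⟨C, a⟩
    simp
  calc prodExp μ F = ∑ C : ι → α, ∑ a, (∏ v, μ v (C v)) * μ w a * F C := by
        refine Finset.sum_congr rfl fun C _ => ?_
        rw [← Finset.sum_mul, ← Finset.mul_sum, h1, mul_one]
    _ = ∑ x : (ι → α) × α, (∏ v, μ v (x.1 v)) * μ w x.2 * F x.1 :=
        (Fintype.sum_prod_type' fun C a => (∏ v, μ v (C v)) * μ w a * F C).symm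
    _ = ∑ x : (ι → α) × α,
          (∏ v, μ v (x.1 v)) * μ w x.2 * F (Function.update x.1 w x.2) := by
        refine (Equiv.sum_comp hswap.toPerm _).symm.trans ?_
        refine Finset.sum_congr rfl fun x _ => ?_
        simp only [Function.Involutive.coe_toPerm]
        rw [key]
    _ = ∑ C : ι → α, ∑ a, (∏ v, μ v (C v)) * μ w a * F (Function.update C w a) :=
        Fintype.sum_prod_type' fun C a => (∏ v, μ v (C v)) * μ w a * F (Function.update C w a)
    _ = _ := by
        refine Finset.sum_congr rfl fun C _ => ?_
        rw [Finset.mul_sum]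
        exact Finset.sum_congr rfl fun a _ => by ring

/-- If `G` ignores the coordinate `w` and `h` has conditional mean at most `ρ` given the other
coordinates, then the expectation of `G * h` is at most `ρ` times that of `G`. -/
lemma prodExp_mul_le (h0 : ∀ w a, 0 ≤ μ w a) (w : ι) (h1 : ∑ a, μ w a = 1)
    {G h : (ι → α) → ℝ} {ρ : ℝ} (hG0 : ∀ C, 0 ≤ G C)
    (hG : ∀ C a, G (Function.update C w a) = G C)
    (hh : ∀ C, ∑ a, μ w a * h (Function.update C w a) ≤ ρ) :
    prodExp μ (fun C => G C * h C) ≤ ρ * prodExp μ G := by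
  rw [prodExp_resample w h1]
  have : ρ * prodExp μ G = prodExp μ (fun C => G C * ρ) := by
    simp only [prodExp, Finset.mul_sum]
    exact Finset.sum_congr rfl fun C _ => by ring
  rw [this]
  refine prodExp_mono h0 fun C => ?_
  calc ∑ a, μ w a * (G (Function.update C w a) * h (Function.update C w a))
      = G C * ∑ a, μ w a * h (Function.update C w a) := by
        rw [Finset.mul_sum]
        exact Finset.sum_congr rfl fun a _ => by rw [hG]; ring
    _ ≤ G C * ρ := mul_le_mul_of_nonneg_left (hh C) (hG0 C)

variable {S : Finset ι} {Conf : α → α → Prop} {π : ℝ}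

/-- Bound on the probability that every element of `T` is confusable with an element of `S` that
precedes it in the order given by `r`. -/
lemma prodExp_prod_earlier_le (h0 : ∀ w a, 0 ≤ μ w a) (h1 : ∀ w, ∑ a, μ w a = 1)
    (hπ : ∀ w ∈ S, ∀ y, ∑ x, μ w x * (if Conf x y then 1 else 0) ≤ π)
    (hπ0 : 0 ≤ π)
    (r : ι → ℤ) (hr : Function.Injective r) (T : Finset ι) (hT : T ⊆ S) :
    prodExp μ (fun C => ∏ w ∈ T,
      if ∃ w' ∈ S, r w' < r w ∧ Conf (C w) (C w') then (1 : ℝ) else 0)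
      ≤ (S.card * π) ^ T.card := by
  induction T using Finset.induction_on_max_value r with
  | empty => simp [prodExp_one h1]
  | insert t T ht hmax ih =>
    have hlt : ∀ w ∈ T, r w < r t := fun w hw =>
      lt_of_le_of_ne (hmax w hw) fun h => ht (hr h ▸ hw)
    rw [Finset.card_insert_of_notMem ht, pow_succ']
    refine le_trans ?_ (mul_le_mul_of_nonneg_left
      (ih ((Finset.subset_insert _ _).trans hT)) (by positivity))
    simp only [Finset.prod_insert ht, mul_comm (ite _ _ _) (Finset.prod _ _)]
    refine prodExp_mul_le h0 t (h1 t) (fun C => Finset.prod_nonneg fun w _ => ?_)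
      (fun C a => Finset.prod_congr rfl fun w hw => ?_) (fun C => ?_)
    · split_ifs <;> norm_num
    · congr 1
      refine propext (exists_congr fun w' => and_congr_right fun _ => and_congr_right fun h => ?_)
      have hw' := h.trans (hlt w hw)
      rw [Function.update_of_ne (fun h' : w = t => ht (h' ▸ hw)),
        Function.update_of_ne (fun h' => by simp [h'] at hw')]
    · calc ∑ a, μ t a * (if ∃ w' ∈ S, r w' < r t ∧ Conf (Function.update C t a t)
              (Function.update C t a w') then (1 : ℝ) else 0)
          ≤ ∑ a, ∑ w' ∈ S, μ t a * (if Conf a (C w') then (1 : ℝ) else 0) := by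
            refine Finset.sum_le_sum fun a _ => ?_
            rw [← Finset.mul_sum]
            refine mul_le_mul_of_nonneg_left ?_ (h0 _ _)
            have hnn : ∀ w' ∈ S, 0 ≤ (if Conf a (C w') then (1 : ℝ) else 0) := fun w' _ => by
              split_ifs <;> norm_num
            split_ifs with h
            · obtain ⟨w', hw', hlt', hc⟩ := h
              rw [Function.update_self,
                Function.update_of_ne (fun h' => by simp [h'] at hlt')] at hc
              refine le_trans ?_ (Finset.single_le_sum hnn hw')
              simp [hc]
            · exact Finset.sum_nonneg hnn
        _ = ∑ w' ∈ S, ∑ a, μ t a * (if Conf a (C w') then (1 : ℝ) else 0) := Finset.sum_comm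
        _ ≤ ∑ w' ∈ S, π :=
            Finset.sum_le_sum fun w' _ => hπ t (hT (Finset.mem_insert_self _ _)) _
        _ = S.card * π := by simp

lemma prodExp_card_earlier_le (h0 : ∀ w a, 0 ≤ μ w a) (h1 : ∀ w, ∑ a, μ w a = 1)
    (hπ : ∀ w ∈ S, ∀ y, ∑ x, μ w x * (if Conf x y then 1 else 0) ≤ π)
    (hπ0 : 0 ≤ π) (r : ι → ℤ) (hr : Function.Injective r) (m : ℕ) :
    prodExp μ (fun C =>
      if m ≤ (S.filter fun w => ∃ w' ∈ S, r w' < r w ∧ Conf (C w) (C w')).card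
      then (1 : ℝ) else 0) ≤ (S.card ^ 2 * π) ^ m := by
  calc _ ≤ prodExp μ (fun C => ∑ T ∈ S.powersetCard m, ∏ w ∈ T,
          if ∃ w' ∈ S, r w' < r w ∧ Conf (C w) (C w') then (1 : ℝ) else 0) := by
        refine prodExp_mono h0 fun C => ?_
        have hnn : ∀ T ∈ S.powersetCard m, 0 ≤ ∏ w ∈ T,
            (if ∃ w' ∈ S, r w' < r w ∧ Conf (C w) (C w') then (1 : ℝ) else 0) :=
          fun T _ => Finset.prod_nonneg fun w _ => by split_ifs <;> norm_num
        split_ifs with h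
        · obtain ⟨T, hT, hcard⟩ := Finset.exists_subset_card_eq h
          have hmem : T ∈ S.powersetCard m :=
            Finset.mem_powersetCard.2 ⟨hT.trans (Finset.filter_subset _ _), hcard⟩
          refine le_trans ?_ (Finset.single_le_sum hnn hmem)
          rw [Finset.prod_congr rfl fun w hw => if_pos (Finset.mem_filter.1 (hT hw)).2]
          simp
        · exact Finset.sum_nonneg hnn
    _ = ∑ T ∈ S.powersetCard m, prodExp μ (fun C => ∏ w ∈ T,
          if ∃ w' ∈ S, r w' < r w ∧ Conf (C w) (C w') then (1 : ℝ) else 0) := prodExp_sum _ _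
    _ ≤ ∑ T ∈ S.powersetCard m, (S.card * π) ^ m := by
        refine Finset.sum_le_sum fun T hT => ?_
        obtain ⟨hTS, hcard⟩ := Finset.mem_powersetCard.1 hT
        simpa [hcard] using prodExp_prod_earlier_le h0 h1 hπ hπ0 r hr T hTS
    _ ≤ (S.card : ℝ) ^ m * (S.card * π) ^ m := by
        rw [Finset.sum_const, Finset.card_powersetCard, nsmul_eq_mul]
        refine mul_le_mul_of_nonneg_right ?_ (by positivity)
        exact_mod_cast Nat.choose_le_pow S.card m
    _ = _ := by rw [← mul_pow]; ring

/-- The elements of `S` whose codeword is confusable with that of another element of `S`. -/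
noncomputable def confusableIn {ι α : Type*} (Conf : α → α → Prop) (S : Finset ι) (C : ι → α) :
    Finset ι :=
  S.filter fun w => ∃ w' ∈ S, w' ≠ w ∧ Conf (C w) (C w')

/-- Tail bound for the number of elements of `S` having a partner in `S`. -/
lemma prodExp_card_confusable_le (h0 : ∀ w a, 0 ≤ μ w a) (h1 : ∀ w, ∑ a, μ w a = 1)
    (hπ : ∀ w ∈ S, ∀ y, ∑ x, μ w x * (if Conf x y then 1 else 0) ≤ π)
    (hπ0 : 0 ≤ π) (r : ι → ℤ) (hr : Function.Injective r) (m : ℕ) :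
    prodExp μ (fun C =>
      if 2 * m ≤ (confusableIn Conf S C).card
      then (1 : ℝ) else 0) ≤ 2 * (S.card ^ 2 * π) ^ m := by
  have hA := prodExp_card_earlier_le h0 h1 hπ hπ0 r hr m
  have hB := prodExp_card_earlier_le h0 h1 hπ hπ0 (fun w => -r w)
    (neg_injective.comp hr) m
  rw [two_mul ((_ : ℝ) ^ m)]
  refine le_trans ?_ (add_le_add hA hB)
  rw [prodExp, prodExp, prodExp, ← Finset.sum_add_distrib]
  simp only [← mul_add]
  refine prodExp_mono h0 fun C => ?_
  have hsub : confusableIn Conf S C ⊆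
      (S.filter fun w => ∃ w' ∈ S, r w' < r w ∧ Conf (C w) (C w')) ∪
      (S.filter fun w => ∃ w' ∈ S, -r w' < -r w ∧ Conf (C w) (C w')) := by
    intro w hw
    simp only [confusableIn, Finset.mem_filter, Finset.mem_union] at hw ⊢
    obtain ⟨hwS, w', hw', hne, hc⟩ := hw
    rcases lt_or_gt_of_ne (hr.ne hne) with h | h
    · exact Or.inl ⟨hwS, w', hw', h, hc⟩
    · exact Or.inr ⟨hwS, w', hw', neg_lt_neg h, hc⟩
  have hle := (Finset.card_le_card hsub).trans (Finset.card_union_le _ _)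
  split_ifs <;> first | omega | norm_num

/-- Union bound: `G` holds except with probability at most the sum of those of the `bad k`. -/
lemma one_sub_le_prodExp (h0 : ∀ w a, 0 ≤ μ w a) (h1 : ∀ w, ∑ a, μ w a = 1)
    (G : (ι → α) → Prop) (N : ℕ) (bad : ℕ → (ι → α) → Prop)
    [∀ k C, Decidable (bad k C)] {η η' : ℝ}
    (hG : ∀ C, (∀ k < N, ¬ bad k C) → G C)
    (hbad : ∀ k < N, prodExp μ (fun C => if bad k C then 1 else 0) ≤ η) (hη : N * η ≤ η') :
    1 - η' ≤ prodExp μ (fun C => if G C then 1 else 0) := by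
  have hle : (1 : ℝ) ≤ prodExp μ (fun C => if G C then 1 else 0) +
      ∑ k ∈ Finset.range N, prodExp μ (fun C => if bad k C then 1 else 0) := by
    rw [← prodExp_sum, ← prodExp_add]
    refine (prodExp_one h1).symm.le.trans (prodExp_mono h0 fun C => ?_)
    have hnn : ∀ k ∈ Finset.range N, (0 : ℝ) ≤ if bad k C then 1 else 0 := fun k _ => by
      split_ifs <;> norm_num
    by_cases hC : G C
    · rw [if_pos hC]
      linarith [Finset.sum_nonneg hnn]
    · have : ∃ k < N, bad k C := by
        by_contra! h
        exact hC (hG C h)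
      obtain ⟨k, hk, hb⟩ := this
      have := Finset.single_le_sum hnn (Finset.mem_range.2 hk)
      rw [if_pos hb] at this
      rw [if_neg hC]
      linarith
  have hsum : ∑ k ∈ Finset.range N, prodExp μ (fun C => if bad k C then 1 else 0) ≤ N * η := by
    simpa using Finset.sum_le_sum fun k hk => hbad k (Finset.mem_range.1 hk)
  linarith

end ProdExp

lemma card_hammingDist_eq {n : ℕ} (y : Fin n → Bool) (k : ℕ) :
    (Finset.univ.filter fun x : Fin n → Bool => hammingDist x y = k).card = n.choose k := by
  have h : ((Finset.univ : Finset (Fin n)).powersetCard k).card = n.choose k := by simp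
  rw [← h]
  refine Finset.card_nbij' (fun x => Finset.univ.filter fun t => x t ≠ y t)
    (fun A t => xor (y t) (decide (t ∈ A))) ?_ ?_ ?_ ?_
  · intro x hx
    simpa [hammingDist] using hx
  · intro A hA
    have hA' : A.card = k := by simpa using hA
    simp only [hammingDist, Finset.coe_filter, Finset.mem_univ, true_and, Set.mem_ofPred_eq]
    rw [← hA']
    congr 1
    ext t
    by_cases ht : t ∈ A <;> cases hy : y t <;> simp [ht, hy]
  · intro x _
    funext t
    cases hx : x t <;> cases hy : y t <;> simp [hx, hy]
  · intro A _
    ext t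
    by_cases ht : t ∈ A <;> cases hy : y t <;> simp [ht, hy]

lemma hammingDist_xorVec {n : ℕ} (x s y : Fin n → Bool) :
    hammingDist (xorVec x s) y = hammingDist x (xorVec y s) := by
  unfold hammingDist
  refine congrArg Finset.card (Finset.filter_congr fun t _ => ?_)
  unfold xorVec
  cases x t <;> cases s t <;> cases y t <;> simp

lemma choose_le_pow_mul_choose_add {n : ℕ} {ν : ℝ} (hν0 : 0 < ν) (hν : ν < 1 / 2) (k j : ℕ)
    (h : ((k + j : ℕ) : ℝ) ≤ ν * n) :
    (n.choose k : ℝ) ≤ (ν / (1 - ν)) ^ j * n.choose (k + j) := by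
  induction j with
  | zero => simp
  | succ j ih =>
    push_cast at h
    have hn : (0 : ℝ) ≤ n := by positivity
    have hkj : k + j ≤ n := by
      have : ((k + j : ℕ) : ℝ) ≤ n := by push_cast; nlinarith
      exact_mod_cast this
    have h1 := ih (by push_cast; linarith)
    refine h1.trans ?_
    rw [pow_succ, mul_assoc]
    refine mul_le_mul_of_nonneg_left ?_ (pow_nonneg (div_nonneg hν0.le (by linarith)) _)
    have h2 : (n.choose (k + j + 1) : ℝ) * (k + j + 1) = n.choose (k + j) * (n - (k + j)) := by
      have := Nat.choose_succ_right_eq n (k + j)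
      have h3 := congrArg (Nat.cast (R := ℝ)) this
      push_cast [Nat.cast_sub hkj] at h3
      exact h3
    rw [← add_assoc, div_mul_eq_mul_div, le_div_iff₀ (by linarith)]
    have h4 : (0 : ℝ) ≤ n.choose (k + j) := by positivity
    have h5 : (0 : ℝ) ≤ n.choose (k + j + 1) := by positivity
    have hpos : (0 : ℝ) < n := by
      rcases hn.lt_or_eq with h | h'
      · exact h
      · rw [← h'] at h
        have : (0 : ℝ) ≤ k + j := by positivity
        nlinarith
    have h6 : (n.choose (k + j) : ℝ) * (1 - ν) * n ≤ ν * n.choose (k + j + 1) * n := by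
      calc (n.choose (k + j) : ℝ) * (1 - ν) * n ≤ n.choose (k + j) * (n - (k + j)) := by
            rw [mul_assoc]; exact mul_le_mul_of_nonneg_left (by nlinarith) h4
        _ = n.choose (k + j + 1) * (k + j + 1) := h2.symm
        _ ≤ n.choose (k + j + 1) * (ν * n) := mul_le_mul_of_nonneg_left (by linarith) h5
        _ = _ := by ring
    exact le_of_mul_le_mul_right h6 hpos

lemma choose_le_choose_of_le_half {n a b : ℕ} (hab : a ≤ b) (hb : 2 * b ≤ n) :
    n.choose a ≤ n.choose b := by
  induction b, hab using Nat.le_induction with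
  | base => rfl
  | succ b _ ih =>
    exact (ih (by omega)).trans (Nat.choose_le_succ_of_lt_half_left (by omega))

lemma card_blockOf_le {N : ℕ} (M : Finset (Fin N)) {B : ℕ} (hB : 0 < B) (k : ℕ) :
    (blockOf M B k).card ≤ B := by
  have hlt : ∀ w ∈ M, ∀ w', w < w' → rankIn M w < rankIn M w' := by
    intro w hw w' h
    refine Finset.card_lt_card ⟨fun v hv => ?_, fun hsub => ?_⟩
    · simp only [Finset.mem_filter] at hv ⊢
      exact ⟨hv.1, hv.2.trans h⟩
    · exact lt_irrefl w (Finset.mem_filter.1 (hsub (Finset.mem_filter.2 ⟨hw, h⟩))).2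
  have : (blockOf M B k).card ≤ (Finset.Ico (k * B) (k * B + B)).card := by
    refine Finset.card_le_card_of_injOn (rankIn M) (fun w hw => ?_) fun w hw w' hw' h => ?_
    · have h : rankIn M w / B = k := (Finset.mem_filter.1 hw).2
      have hmod := Nat.mod_lt (rankIn M w) hB
      have := Nat.div_add_mod (rankIn M w) B
      rw [h, mul_comm] at this
      simp only [Finset.coe_Ico, Set.mem_Ico]
      omega
    · have hwM := (Finset.mem_filter.1 hw).1
      have hwM' := (Finset.mem_filter.1 hw').1
      rcases lt_trichotomy w w' with h' | h' | h'
      · exact absurd h (hlt w hwM w' h').ne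
      · exact h'
      · exact absurd h (hlt w' hwM' w h').ne'
  simpa using this

/-- Shells whose relative radius lies in `[ν, 1 - ν]` meet any Hamming ball of relative radius
`t ≤ ν - γ` in an exponentially small proportion. -/
lemma card_shell_inter_ball_le {n d : ℕ} {ν γ t : ℝ} (z y s : Fin n → Bool)
    (hν0 : 0 < ν) (hν : ν < 1 / 2) (hγ : 0 ≤ γ) (htν : t + γ ≤ ν)
    (hd : ν * n ≤ d) (hd' : ν * n ≤ n - d) :
    ((Finset.univ.filter fun x : Fin n → Bool =>
      hammingDist x z = d ∧ (hammingDist (xorVec x s) y : ℝ) ≤ t * n).card : ℝ) ≤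
      (n + 1) * (ν / (1 - ν)) ^ (γ * n - 1) * n.choose d := by
  set ρ := ν / (1 - ν) with hρ
  have hρ0 : 0 < ρ := div_pos hν0 (by linarith)
  have hρ1 : ρ ≤ 1 := (div_le_one (by linarith)).2 (by linarith)
  have hn : (0 : ℝ) ≤ n := by positivity
  have hdn : d ≤ n := by
    have : (d : ℝ) ≤ n := by nlinarith
    exact_mod_cast this
  have hL : n.choose ⌊ν * n⌋₊ ≤ n.choose d := by
    rcases le_total (2 * d) n with h | h
    · exact choose_le_choose_of_le_half (Nat.floor_le_of_le hd) h
    · rw [← Nat.choose_symm hdn]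
      refine choose_le_choose_of_le_half (Nat.floor_le_of_le ?_) (by omega)
      rwa [Nat.cast_sub hdn]
  have hterm : ∀ k : ℕ, (k : ℝ) ≤ t * n →
      (n.choose k : ℝ) ≤ ρ ^ (γ * n - 1) * n.choose d := by
    intro k hk
    have hγn : 0 ≤ γ * n := by positivity
    have hkν : (k : ℝ) + γ * n ≤ ν * n := by nlinarith
    have hkL : k ≤ ⌊ν * n⌋₊ := Nat.le_floor (by linarith)
    obtain ⟨j, hj⟩ := Nat.exists_eq_add_of_le hkL
    have hfl := Nat.lt_floor_add_one (ν * n)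
    have hj' : γ * n - 1 ≤ j := by
      rw [hj] at hfl
      push_cast at hfl
      linarith
    calc (n.choose k : ℝ) ≤ ρ ^ j * n.choose (k + j) :=
          choose_le_pow_mul_choose_add hν0 hν k j
            (by rw [← hj]; exact Nat.floor_le (by positivity))
      _ ≤ ρ ^ (γ * n - 1) * n.choose d := by
          rw [← hj, ← Real.rpow_natCast]
          exact mul_le_mul (Real.rpow_le_rpow_of_exponent_ge hρ0 hρ1 hj') (by exact_mod_cast hL)
            (by positivity) (by positivity)
  have hsub : (Finset.univ.filter fun x : Fin n → Bool =>
      hammingDist x z = d ∧ (hammingDist (xorVec x s) y : ℝ) ≤ t * n) ⊆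
      ((Finset.range (n + 1)).filter fun k : ℕ => (k : ℝ) ≤ t * n).biUnion fun k =>
        Finset.univ.filter fun x : Fin n → Bool => hammingDist x (xorVec y s) = k := by
    intro x hx
    simp only [Finset.mem_filter, Finset.mem_univ, true_and, Finset.mem_biUnion,
      Finset.mem_range] at hx ⊢
    rw [hammingDist_xorVec] at hx
    refine ⟨_, ⟨?_, hx.2⟩, rfl⟩
    have := hammingDist_le_card_fintype (x := x) (y := xorVec y s)
    rw [Fintype.card_fin] at this
    omega
  have hcard := (Finset.card_le_card hsub).trans Finset.card_biUnion_le
  simp only [card_hammingDist_eq] at hcard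
  calc _ ≤ ((∑ k ∈ (Finset.range (n + 1)).filter fun k : ℕ => (k : ℝ) ≤ t * n,
          n.choose k : ℕ) : ℝ) := by exact_mod_cast hcard
    _ ≤ ∑ k ∈ (Finset.range (n + 1)).filter fun k : ℕ => (k : ℝ) ≤ t * n,
          ρ ^ (γ * n - 1) * n.choose d := by
        push_cast
        exact Finset.sum_le_sum fun k hk => hterm k (Finset.mem_filter.1 hk).2
    _ ≤ ∑ k ∈ Finset.range (n + 1), ρ ^ (γ * n - 1) * n.choose d :=
        Finset.sum_le_sum_of_subset_of_nonneg (Finset.filter_subset _ _)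
          fun _ _ _ => by positivity
    _ = _ := by simp; ring

lemma natCard_shell {n : ℕ} (z : Fin n → Bool) (d : ℕ) :
    Nat.card {x : Fin n → Bool // hammingDist x z = d} = n.choose d := by
  rw [Nat.card_eq_fintype_card, Fintype.card_subtype, ← card_hammingDist_eq z d]

/-- The mass function of the codeword of message `w` under `shellCodeProb`. -/
noncomputable def shellMass {n N : ℕ} (M : Finset (Fin N)) (z : Fin n → Bool) (d : ℕ)
    (w : Fin N) (x : Fin n → Bool) : ℝ :=
  if w ∈ M then
    (if hammingDist x z = d then
      (1 : ℝ) / (Nat.card {x : Fin n → Bool // hammingDist x z = d} : ℝ)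
    else 0)
  else
    (if hammingDist x z = d then 0
    else (1 : ℝ) /
      ((2 : ℝ) ^ n - (Nat.card {x : Fin n → Bool // hammingDist x z = d} : ℝ)))

lemma shellMass_nonneg {n N : ℕ} (M : Finset (Fin N)) (z : Fin n → Bool) (d : ℕ)
    (w : Fin N) (x : Fin n → Bool) : 0 ≤ shellMass M z d w x := by
  have : (n.choose d : ℝ) ≤ 2 ^ n := by exact_mod_cast Nat.choose_le_two_pow n d
  unfold shellMass
  rw [natCard_shell]
  split_ifs
  · positivity
  · rfl
  · rfl
  · exact div_nonneg zero_le_one (by linarith)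

lemma sum_shellMass {n N d : ℕ} (M : Finset (Fin N)) (z : Fin n → Bool) (hn : 0 < n)
    (hd : d ≤ n) (w : Fin N) : ∑ x, shellMass M z d w x = 1 := by
  have hlt : n.choose d < 2 ^ n := by
    rw [← Nat.sum_range_choose]
    rcases Nat.eq_zero_or_pos d with rfl | h
    · refine Finset.single_lt_sum (i := 0) (j := n) (by omega) (by simp) (by simp) (by simp)
        (fun _ _ _ => Nat.zero_le _)
    · refine Finset.single_lt_sum (i := d) (j := 0) (by omega) (by simp; omega) (by simp)
        (by simp) (fun _ _ _ => Nat.zero_le _)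
  have hlt' : (n.choose d : ℝ) < 2 ^ n := by exact_mod_cast hlt
  have hpos : (0 : ℝ) < n.choose d := by exact_mod_cast Nat.choose_pos hd
  have hc := card_hammingDist_eq z d
  unfold shellMass
  rw [natCard_shell]
  split_ifs
  · rw [← Finset.sum_filter, Finset.sum_const, hc, nsmul_eq_mul, mul_one_div_cancel hpos.ne']
  · have hsplit := Finset.card_filter_add_card_filter_not (s := Finset.univ)
      (fun x : Fin n → Bool => hammingDist x z = d)
    rw [hc] at hsplit
    have hnot : ((Finset.univ.filter fun x : Fin n → Bool => ¬ hammingDist x z = d).card : ℝ)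
        = 2 ^ n - n.choose d := by
      rw [eq_sub_iff_add_eq']
      have : (Finset.univ : Finset (Fin n → Bool)).card = 2 ^ n := by simp
      rw [this] at hsplit
      exact_mod_cast hsplit
    simp only [← ite_not (hammingDist _ z = d)]
    rw [← Finset.sum_filter, Finset.sum_const, nsmul_eq_mul, hnot,
      mul_one_div_cancel (by linarith)]

lemma eventually_mul_succ_le_exp {a : ℝ} (ha : 0 < a) (K : ℝ) :
    ∀ᶠ n : ℕ in Filter.atTop, K * ((n : ℝ) + 1) ≤ Real.exp (a * n) := by
  have h := (tendsto_natCast_atTop_atTop (R := ℝ)).eventually_ge_atTop (4 * |K| / a ^ 2)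
  filter_upwards [h, Filter.eventually_ge_atTop 1] with n hn hn1
  have hn1' : (1 : ℝ) ≤ n := by exact_mod_cast hn1
  rw [div_le_iff₀ (by positivity)] at hn
  calc K * ((n : ℝ) + 1) ≤ |K| * (2 * n) :=
        mul_le_mul (le_abs_self K) (by linarith) (by positivity) (abs_nonneg K)
    _ ≤ (a * n) ^ 2 / 2 := by nlinarith
    _ ≤ Real.exp (a * n) := by
        have := Real.quadratic_le_exp_of_nonneg (x := a * n) (by positivity)
        have : 0 ≤ a * n := by positivity
        linarith

/-- The row and block conclusions, for a block with few confusable messages. -/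
lemma block_bounds_of_card_confusableIn_lt {ι α : Type*} [Fintype ι] {Conf : α → α → Prop}
    {S : Finset ι} {C : ι → α} {n : ℕ} {K : ℝ} (hn : 2 ≤ n) (hK : 2 * (n : ℝ) ≤ K)
    (h : (confusableIn Conf S C).card < 2 * n) :
    (∀ (a : ℕ) (e : Fin a × Fin a ≃ {w // w ∈ S}) (i : Fin a),
      (Nat.card {j : Fin a // ∃ i' j' : Fin a, i' ≠ i ∧
        Conf (C (e (i, j)).1) (C (e (i', j')).1)} : ℝ) ≤ 1 ^ 2 * (n : ℝ) ^ 4) ∧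
    (Nat.card {w // w ∈ S ∧ ∃ w', w' ∈ S ∧ w' ≠ w ∧ Conf (C w) (C w')} : ℝ) ≤ K := by
  have hfew : ((confusableIn Conf S C).card : ℝ) ≤ 2 * n := by exact_mod_cast h.le
  refine ⟨fun a e i => ?_, ?_⟩
  · have hle : Nat.card {j : Fin a // ∃ i' j' : Fin a, i' ≠ i ∧
        Conf (C (e (i, j)).1) (C (e (i', j')).1)} ≤ (confusableIn Conf S C).card := by
      rw [Nat.card_eq_fintype_card, Fintype.card_subtype]
      refine Finset.card_le_card_of_injOn (fun j => (e (i, j)).1) (fun j hj => ?_)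
        fun j _ j' _ h => ?_
      · obtain ⟨i', j', hne, hc⟩ := (Finset.mem_filter.1 hj).2
        refine Finset.mem_filter.2 ⟨(e (i, j)).2, (e (i', j')).1, (e (i', j')).2, fun h => hne ?_,
          hc⟩
        exact congrArg Prod.fst (e.injective (Subtype.ext h))
      · exact congrArg Prod.snd (e.injective (Subtype.ext h))
    have h2 : (2 : ℝ) ≤ n := by exact_mod_cast hn
    have h3 : (2 : ℝ) * n ≤ 1 ^ 2 * (n : ℝ) ^ 4 := by
      have h5 : (2 : ℝ) * n ≤ (n : ℝ) ^ 2 := by nlinarith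
      have h6 : (n : ℝ) ^ 2 ≤ (n : ℝ) ^ 4 := pow_le_pow_right₀ (by linarith) (by norm_num)
      linarith
    exact (Nat.cast_le.2 hle).trans (hfew.trans h3)
  · have heq : Nat.card {w // w ∈ S ∧ ∃ w', w' ∈ S ∧ w' ≠ w ∧ Conf (C w) (C w')} =
        (confusableIn Conf S C).card := by
      rw [Nat.card_eq_fintype_card, Fintype.card_subtype, confusableIn]
      congr 1
      ext w
      simp
    rw [heq]
    exact hfew.trans hK

lemma sq_mul_decay_le {B n : ℕ} {δ θ γ ρ : ℝ} (hρ0 : 0 < ρ) (hθ : θ = -(γ * Real.log ρ))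
    (hδ : 0 < δ) (hδθ : δ ≤ θ / 4) (hB : (B : ℝ) ≤ 2 * 2 ^ ((n : ℝ) * δ))
    (hn : 4 / ρ * ((n : ℝ) + 1) ≤ Real.exp (θ / 4 * n)) :
    (B : ℝ) ^ 2 * ((n + 1) * ρ ^ (γ * n - 1)) ≤ Real.exp (-(θ / 4 * n)) := by
  have hlog2 : 0 < Real.log 2 := Real.log_pos (by norm_num)
  have hlog2' : Real.log 2 < 1 := by linarith [Real.log_two_lt_d9]
  have e1 : (2 : ℝ) ^ ((n : ℝ) * δ) ≤ Real.exp (θ / 4 * n) := by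
    rw [Real.rpow_def_of_pos (by norm_num)]
    refine Real.exp_le_exp.2 ?_
    have h1 : Real.log 2 * δ ≤ θ / 4 := by nlinarith
    calc Real.log 2 * (n * δ) = Real.log 2 * δ * n := by ring
      _ ≤ θ / 4 * n := mul_le_mul_of_nonneg_right h1 (by positivity)
  have e2 : ρ ^ (γ * n - 1) = Real.exp (-(θ * n)) / ρ := by
    rw [Real.rpow_sub hρ0, Real.rpow_one, Real.rpow_def_of_pos hρ0]
    congr 2
    rw [hθ]; ring
  calc (B : ℝ) ^ 2 * ((n + 1) * ρ ^ (γ * n - 1))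
      ≤ (2 * Real.exp (θ / 4 * n)) ^ 2 * ((n + 1) * ρ ^ (γ * n - 1)) := by
        gcongr; linarith
    _ = (4 / ρ * (n + 1)) * (Real.exp (θ / 4 * n) ^ 2 * Real.exp (-(θ * n))) := by
        rw [e2]; ring
    _ ≤ Real.exp (θ / 4 * n) * (Real.exp (θ / 4 * n) ^ 2 * Real.exp (-(θ * n))) := by gcongr
    _ = Real.exp (-(θ / 4 * n)) := by
        rw [← Real.exp_nat_mul, ← Real.exp_add, ← Real.exp_add]
        congr 1
        push_cast
        ring

lemma ceil_mul_exp_pow_le {N n : ℕ} {R θ : ℝ} (hN : N = ⌈(2 : ℝ) ^ (R * n)⌉₊)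
    (hnR : 2 + |R| ≤ θ / 8 * n) (hn2 : 2 ≤ n) :
    N * (2 * Real.exp (-(θ / 4 * n)) ^ n) ≤ Real.exp (-(θ / 8) * (n : ℝ) ^ 2) := by
  have h2 : (2 : ℝ) ≤ n := by exact_mod_cast hn2
  have hlog2 : 0 < Real.log 2 := Real.log_pos (by norm_num)
  have hlog2' : Real.log 2 < 1 := by linarith [Real.log_two_lt_d9]
  have hNle : (N : ℝ) ≤ 2 * Real.exp (|R| * n) := by
    have h2 : (2 : ℝ) ^ (R * n) ≤ Real.exp (|R| * n) := by
      rw [Real.rpow_def_of_pos (by norm_num)]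
      refine Real.exp_le_exp.2 ?_
      have h3 : R * n ≤ |R| * n := mul_le_mul_of_nonneg_right (le_abs_self R) (by positivity)
      have h4 : 0 ≤ |R| * n := by positivity
      nlinarith
    have h3 : 1 ≤ Real.exp (|R| * n) := Real.one_le_exp (by positivity)
    have := (Nat.ceil_lt_add_one (a := (2 : ℝ) ^ (R * n)) (by positivity)).le
    rw [← hN] at this
    linarith
  have he : (4 : ℝ) ≤ Real.exp 2 := by
    have h := Real.add_one_le_exp (1 : ℝ)
    have h' : Real.exp 2 = Real.exp 1 * Real.exp 1 := by rw [← Real.exp_add]; norm_num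
    nlinarith
  calc N * (2 * Real.exp (-(θ / 4 * n)) ^ n)
      ≤ 2 * Real.exp (|R| * n) * (2 * Real.exp (-(θ / 4 * n)) ^ n) := by gcongr
    _ = 4 * (Real.exp (|R| * n) * Real.exp (-(θ / 4 * n)) ^ n) := by ring
    _ ≤ Real.exp 2 * (Real.exp (|R| * n) * Real.exp (-(θ / 4 * n)) ^ n) := by gcongr
    _ = Real.exp (2 + |R| * n - θ / 4 * n ^ 2) := by
        rw [← Real.exp_nat_mul, ← Real.exp_add, ← Real.exp_add]
        congr 1
        ring
    _ ≤ _ := by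
        refine Real.exp_le_exp.2 ?_
        have := mul_le_mul_of_nonneg_right hnR (by linarith : (0 : ℝ) ≤ n)
        nlinarith

lemma shellMass_confusable_le {n N d : ℕ} {ν γ t : ℝ} (M : Finset (Fin N))
    (z s : Fin n → Bool) (hν0 : 0 < ν) (hν : ν < 1 / 2) (hγ : 0 ≤ γ) (htν : t + γ ≤ ν)
    (hd : ν * n ≤ d) (hd' : ν * n ≤ n - d) (hdn : d ≤ n) {w : Fin N} (hw : w ∈ M)
    (y : Fin n → Bool) :
    ∑ x, shellMass M z d w x *
      (if (hammingDist (xorVec x s) y : ℝ) ≤ t * n then 1 else 0) ≤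
      (n + 1) * (ν / (1 - ν)) ^ (γ * n - 1) := by
  have hcp : (0 : ℝ) < n.choose d := by exact_mod_cast Nat.choose_pos hdn
  have : ∑ x, shellMass M z d w x *
      (if (hammingDist (xorVec x s) y : ℝ) ≤ t * n then 1 else 0) =
      (Finset.univ.filter fun x =>
        hammingDist x z = d ∧ (hammingDist (xorVec x s) y : ℝ) ≤ t * n).card
        / (n.choose d : ℝ) := by
    rw [Finset.card_filter, Nat.cast_sum, Finset.sum_div]
    refine Finset.sum_congr rfl fun x _ => ?_
    simp only [shellMass, if_pos hw, natCard_shell]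
    by_cases hA : hammingDist x z = d <;>
      by_cases hB : (hammingDist (xorVec x s) y : ℝ) ≤ t * n <;> simp [hA, hB]
  rw [this, div_le_iff₀ hcp]
  exact card_shell_inter_ball_le z y s hν0 hν hγ htν hd hd'

/-- **List-decoding inside the oracle-given set via the square-grid argument (Lemma 7 of
the paper).** For all sufficiently small `ε₁, ε₂, δ > 0` there are `β > 0` and a constant
`c` such that for all large `n`, for every `z`, every `d` with `|d - qn| ≤ ε₁n`, every
state vector `s` of weight at most `pn` and every admissible set `M` of messages on the
shell `Sh(z,d)`, with probability at least `1 - e^{-βn²}` over the conditional code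
distribution, for every full block `M^{(k)}` of the ordered partition of `M`:
(i) in any arrangement of the block as a square array, every row contains at most `c²n⁴`
codewords confusable (under `s`) with a codeword in a different row, and
(ii) at most `2^{n·3δ/4}` messages `w ∈ M^{(k)}` are confusable (under `s`) with another
message of `M^{(k)}`. -/
theorem list_decoding_inside_block (p q R : ℝ) (hp0 : 0 < p) (hpq : p < q)
    (hq : q ≤ 1 / 2) (hR1 : 1 - binH q < R) (hR2 : R < 1 - binH p) :
    ∃ ε₀ > (0 : ℝ), ∀ ε₁ ε₂ δ : ℝ,
      0 < ε₁ → ε₁ ≤ ε₀ → 0 < ε₂ → ε₂ ≤ ε₀ → 0 < δ → δ ≤ ε₀ →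
      ∃ β > (0 : ℝ), ∃ c : ℝ, ∃ n₀ : ℕ, ∀ n : ℕ, n₀ ≤ n →
      ∀ N : ℕ, N = ⌈(2 : ℝ) ^ (R * n)⌉₊ →
      ∀ B : ℕ, B = ⌈(2 : ℝ) ^ ((n : ℝ) * δ)⌉₊ →
      ∀ (z : Fin n → Bool) (d : ℕ), |(d : ℝ) - q * n| ≤ ε₁ * n →
      ∀ s : Fin n → Bool, (wt s : ℝ) ≤ p * n →
      ∀ M : Finset (Fin N),
        (2 : ℝ) ^ ((n : ℝ) * (binH ((d : ℝ) / n) + R - 1 - ε₂)) ≤ (M.card : ℝ) →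
        (M.card : ℝ) ≤ (2 : ℝ) ^ ((n : ℝ) * (binH ((d : ℝ) / n) + R - 1 + ε₂)) →
        1 - Real.exp (-β * (n : ℝ) ^ 2) ≤
          ∑ C : Fin N → Fin n → Bool, shellCodeProb n N M z d C *
            (if ∀ k : ℕ, (k + 1) * B ≤ M.card →
                (∀ a : ℕ, a * a = B →
                  ∀ e : Fin a × Fin a ≃ {w : Fin N // w ∈ blockOf M B k},
                  ∀ i : Fin a,
                    (Nat.card {j : Fin a // ∃ i' j' : Fin a, i' ≠ i ∧
                        (hammingDist (xorVec (C (e (i, j)).1) s) (C (e (i', j')).1) : ℝ)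
                          ≤ (p + ε₁) * n} : ℝ)
                      ≤ c ^ 2 * (n : ℝ) ^ 4) ∧
                (Nat.card {w : Fin N // w ∈ blockOf M B k ∧ ∃ w' : Fin N,
                    w' ∈ blockOf M B k ∧ w' ≠ w ∧
                    (hammingDist (xorVec (C w) s) (C w') : ℝ) ≤ (p + ε₁) * n} : ℝ)
                  ≤ (2 : ℝ) ^ ((n : ℝ) * (3 * δ / 4))
              then (1 : ℝ) else 0) := by
  set ν : ℝ := (p + q) / 2 with hν
  set γ : ℝ := (q - p) / 4 with hγ
  have hγ0 : 0 < γ := by rw [hγ]; linarith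
  have hν0 : 0 < ν := by rw [hν]; linarith
  have hν1 : ν < 1 / 2 := by rw [hν]; linarith
  set ρ : ℝ := ν / (1 - ν) with hρ
  have hρ0 : 0 < ρ := div_pos hν0 (by linarith)
  have hρ1 : ρ < 1 := (div_lt_one (by linarith)).2 (by linarith)
  set θ : ℝ := -(γ * Real.log ρ) with hθ
  have hθ0 : 0 < θ := by
    have := mul_pos hγ0 (neg_pos.2 (Real.log_neg hρ0 hρ1))
    rw [hθ]; linarith
  refine ⟨min γ (θ / 4), lt_min hγ0 (by linarith), ?_⟩
  intro ε₁ ε₂ δ hε₁ hε₁' _ _ hδ hδ'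
  have hε₁γ := hε₁'.trans (min_le_left _ _)
  have hδθ := hδ'.trans (min_le_right _ _)
  have hlog2 : 0 < Real.log 2 := Real.log_pos (by norm_num)
  have hev : ∀ᶠ n : ℕ in Filter.atTop, 2 ≤ n ∧
      2 * ((n : ℝ) + 1) ≤ Real.exp (3 * δ / 4 * Real.log 2 * n) ∧
      4 / ρ * ((n : ℝ) + 1) ≤ Real.exp (θ / 4 * n) ∧
      2 + |R| ≤ θ / 8 * n := by
    refine (Filter.eventually_ge_atTop 2).and
      ((eventually_mul_succ_le_exp (by positivity) _).and
        ((eventually_mul_succ_le_exp (by positivity) _).and ?_))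
    have := (tendsto_natCast_atTop_atTop (R := ℝ)).eventually_ge_atTop ((2 + |R|) / (θ / 8))
    filter_upwards [this] with n hn
    rwa [div_le_iff₀' (by positivity)] at hn
  obtain ⟨n₀, hn₀⟩ := Filter.eventually_atTop.1 hev
  refine ⟨θ / 8, by positivity, 1, n₀, ?_⟩
  intro n hn N hN B hB z d hd s _ M _ _
  obtain ⟨hn2, hexp1, hexp2, hnR⟩ := hn₀ n hn
  have hnpos : (0 : ℝ) < n := by exact_mod_cast (by omega : 0 < n)
  obtain ⟨hd1, hd2⟩ := abs_le.1 hd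
  have hνd : ν * n ≤ d := by
    have : ν * n ≤ (q - ε₁) * n := mul_le_mul_of_nonneg_right (by linarith) hnpos.le
    linarith
  have hνd' : ν * n ≤ n - d := by
    have : ν * n ≤ (1 - q - ε₁) * n := mul_le_mul_of_nonneg_right (by linarith) hnpos.le
    linarith
  have hdn : d ≤ n := by
    have : (d : ℝ) ≤ n := by nlinarith
    exact_mod_cast this
  have hpow1 : (1 : ℝ) ≤ 2 ^ ((n : ℝ) * δ) := Real.one_le_rpow (by norm_num) (by positivity)
  have hB0 : 0 < B := by rw [hB]; exact Nat.ceil_pos.2 (by linarith)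
  have hBle : (B : ℝ) ≤ 2 * 2 ^ ((n : ℝ) * δ) := by
    have := (Nat.ceil_lt_add_one (zero_le_one.trans hpow1)).le
    rw [← hB] at this
    linarith
  have hBπ := sq_mul_decay_le hρ0 hθ hδ hδθ hBle hexp2
  have h0 := shellMass_nonneg M z d
  have h1 := sum_shellMass M z (by omega) hdn
  have hK : 2 * (n : ℝ) ≤ 2 ^ ((n : ℝ) * (3 * δ / 4)) := by
    rw [Real.rpow_def_of_pos (by norm_num)]
    refine le_trans (by linarith) (hexp1.trans_eq ?_)
    congr 1
    ring
  refine one_sub_le_prodExp h0 h1 _ N (fun k C => 2 * n ≤ (confusableIn (fun x y =>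
      (hammingDist (xorVec x s) y : ℝ) ≤ (p + ε₁) * n) (blockOf M B k) C).card)
    (fun C hC k hk => ?_) (fun k _ => ?_) (ceil_mul_exp_pow_le hN hnR hn2)
  · have hkN : k < N := by
      have hMN : M.card ≤ N := by simpa using Finset.card_le_univ M
      nlinarith
    obtain ⟨hrow, hcard⟩ := block_bounds_of_card_confusableIn_lt hn2 hK (not_le.1 (hC k hkN))
    exact ⟨fun a _ => hrow a, hcard⟩
  · refine (prodExp_card_confusable_le (S := blockOf M B k) h0 h1
      (fun w hw => shellMass_confusable_le (t := p + ε₁) M z s hν0 hν1 hγ0.le (by linarith) hνd hνd' hdn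
        (Finset.filter_subset _ _ hw)) (by positivity)
      (fun w => ((w : ℕ) : ℤ)) (fun a b h => Fin.ext (by simpa using h)) n).trans ?_
    have hcB : ((blockOf M B k).card : ℝ) ≤ B := by exact_mod_cast card_blockOf_le M hB0 k
    refine mul_le_mul_of_nonneg_left (pow_le_pow_left₀ (by positivity) (le_trans ?_ hBπ) n)
      (by norm_num)
    gcongr
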